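/- arXiv:2101.00191 — 3 statements merged into one kernel-verified Lean document; each statement's English description precedes it below -/
import Mathlib

section
/- Suppose θ_j > θ_{j*} > 0, let ζ_j, ζ_{j*} : Fin N → ℝ be nonnegative information-significance vectors and φ_j, φ_{j*} : Fin N → ℝ payment vectors, and suppose both incentive-compatibility inequalities hold: θ_j·S(ζ_j) − C(φ_j) ≥ θ_j·S(ζ_{j*}) − C(φ_{j*}) and θ_{j*}·S(ζ_{j*}) − C(φ_{j*}) ≥ θ_{j*}·S(ζ_j) − C(φ_j). Then S(ζ_j) ≥ S(ζ_{j*}), and consequently ∑ n, ρ n · ζ_j n ≥ ∑ n, ρ n · ζ_{j*} n. -/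
/-- Under both IC inequalities with θ_j > θ_{j*} > 0 and nonnegative
information-significance vectors, the satisfaction of the higher type's contract is
at least that of the lower type, and hence the weighted sums of significance compare. -/
theorem stmt_0 (N : ℕ) (hN : 1 ≤ N) (ρ : Fin N → ℝ)
    (hρ : ∀ n, 0 ≤ ρ n ∧ ρ n ≤ 1) (lam : ℝ) (hlam : 0 < lam)
    (θj θj' : ℝ) (hθ : θj' < θj) (hθ' : 0 < θj')
    (ζj ζj' φj φj' : Fin N → ℝ)
    (hζj : ∀ n, 0 ≤ ζj n) (hζj' : ∀ n, 0 ≤ ζj' n)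
    (hIC1 : θj * (lam * Real.sqrt (∑ n, ρ n * ζj n)) - (∑ n, ρ n * φj n) ≥
      θj * (lam * Real.sqrt (∑ n, ρ n * ζj' n)) - (∑ n, ρ n * φj' n))
    (hIC2 : θj' * (lam * Real.sqrt (∑ n, ρ n * ζj' n)) - (∑ n, ρ n * φj' n) ≥
      θj' * (lam * Real.sqrt (∑ n, ρ n * ζj n)) - (∑ n, ρ n * φj n)) :
    lam * Real.sqrt (∑ n, ρ n * ζj n) ≥ lam * Real.sqrt (∑ n, ρ n * ζj' n) ∧
      (∑ n, ρ n * ζj n) ≥ (∑ n, ρ n * ζj' n) := by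
  have h0 : 0 ≤ ∑ n, ρ n * ζj n :=
    Finset.sum_nonneg fun n _ => mul_nonneg (hρ n).1 (hζj n)
  have h1 : lam * Real.sqrt (∑ n, ρ n * ζj' n) ≤ lam * Real.sqrt (∑ n, ρ n * ζj n) := by
    by_contra hc
    have hc' := not_le.mp hc
    have := mul_pos (sub_pos.mpr hθ) (sub_pos.mpr hc')
    linarith
  exact ⟨h1, (Real.sqrt_le_sqrt_iff h0).mp (le_of_mul_le_mul_left h1 hlam)⟩
end

section
/- Let θ, s, c : ℕ → ℝ be sequences such that θ and s are nondecreasing (θ j ≤ θ (j+1) and s j ≤ s (j+1) for all j), and suppose the local upward incentive constraints (LUIC) hold: for every j, θ j · s j − c j ≥ θ j · s (j+1) − c (j+1). Then all upward incentive constraints hold: for all indices i ≤ j, θ i · s i − c i ≥ θ i · s j − c j. -/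
/-- If θ and s are nondecreasing and the local upward incentive
constraints hold, then all upward incentive constraints hold. -/
theorem stmt_6 (θ s c : ℕ → ℝ)
    (hθ : ∀ j, θ j ≤ θ (j + 1)) (hs : ∀ j, s j ≤ s (j + 1))
    (hLUIC : ∀ j, θ j * s j - c j ≥ θ j * s (j + 1) - c (j + 1)) :
    ∀ i j, i ≤ j → θ i * s i - c i ≥ θ i * s j - c j := by
  intro i j hij
  induction j, hij using Nat.le_induction with
  | base => exact le_refl _
  | succ k hk ih =>
    have h1 : θ i ≤ θ k := monotone_nat_of_le_succ hθ hk
    have h2 := hLUIC k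
    have h3 := mul_nonneg (sub_nonneg.2 h1) (sub_nonneg.2 (hs k))
    nlinarith [h1, h2, h3, ih]
end

section
/- For every natural number N ≥ 2, ∫_{0}^{1} exp(∑_{n=1}^{N−1} vⁿ/n) dv ≤ Real.log N + (1/N) · exp(∑_{n=1}^{N−1} 1/n). -/
theorem aux_bound (M : ℕ) (v : ℝ) (h0 : 0 ≤ v) (h1 : v < 1) :
    Real.exp (∑ n ∈ Finset.Icc 1 M, v ^ n / (n : ℝ)) ≤ (1 - v)⁻¹ := by
  have hpos : 0 < 1 - v := by linarith
  have hs := Real.hasSum_pow_div_log_of_abs_lt_one (x := v) (by rwa [abs_of_nonneg h0])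
  have h2 := hs.summable.sum_le_tsum (Finset.range M) (fun i _ => by positivity)
  rw [hs.tsum_eq] at h2
  have h3 : ∑ n ∈ Finset.Icc 1 M, v ^ n / (n : ℝ)
      = ∑ i ∈ Finset.range M, v ^ (i + 1) / ((i : ℝ) + 1) := by
    rw [Finset.range_eq_Ico, Finset.sum_Ico_add' (fun n : ℕ => v ^ n / (n : ℝ)) 0 M 1 |>.symm.trans
      (Finset.sum_congr rfl (fun i _ => by push_cast; rfl)) |>.symm]
    rfl
  rw [h3, ← Real.exp_log (inv_pos.mpr hpos), Real.log_inv]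
  exact Real.exp_le_exp.mpr h2

/-- For N ≥ 2,
∫₀¹ exp(∑_{n=1}^{N−1} vⁿ/n) dv ≤ log N + (1/N) exp(∑_{n=1}^{N−1} 1/n). -/
theorem stmt_13 (N : ℕ) (hN : 2 ≤ N) :
    (∫ v in (0 : ℝ)..1, Real.exp (∑ n ∈ Finset.Icc 1 (N - 1), v ^ n / (n : ℝ))) ≤
      Real.log N + (1 / (N : ℝ)) * Real.exp (∑ n ∈ Finset.Icc 1 (N - 1), 1 / (n : ℝ)) := by
  have hN' : (2 : ℝ) ≤ N := by exact_mod_cast hN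
  have hNp : (0 : ℝ) < N := by linarith
  have hd : 0 < 1 / (N : ℝ) := by positivity
  have hd1 : 1 / (N : ℝ) ≤ 1 := by rw [div_le_one hNp]; linarith
  have hc : Continuous (fun v : ℝ => Real.exp (∑ n ∈ Finset.Icc 1 (N - 1), v ^ n / (n : ℝ))) := by
    fun_prop
  rw [← intervalIntegral.integral_add_adjacent_intervals (b := 1 - 1 / (N : ℝ))
    (hc.intervalIntegrable _ _) (hc.intervalIntegrable _ _)]
  apply add_le_add
  · have e : ∫ v in (0 : ℝ)..(1 - 1 / (N : ℝ)), (1 - v)⁻¹ = Real.log N := by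
      rw [intervalIntegral.integral_comp_sub_left (fun x : ℝ => x⁻¹) 1,
        integral_inv_of_pos (by simpa using hNp) (by norm_num)]
      simp
    rw [← e]
    apply intervalIntegral.integral_mono_on (by linarith) (hc.intervalIntegrable _ _)
    · apply ContinuousOn.intervalIntegrable
      rw [Set.uIcc_of_le (by linarith)]
      apply ContinuousOn.inv₀ (by fun_prop)
      intro x hx
      have := hx.2
      linarith
    · intro x hx
      exact aux_bound _ x hx.1 (by have := hx.2; linarith)
  · have e : ∫ v in (1 - 1 / (N : ℝ))..1,
        Real.exp (∑ n ∈ Finset.Icc 1 (N - 1), 1 / (n : ℝ)) =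
        (1 / (N : ℝ)) * Real.exp (∑ n ∈ Finset.Icc 1 (N - 1), 1 / (n : ℝ)) := by
      rw [intervalIntegral.integral_const, smul_eq_mul]
      ring
    rw [← e]
    apply intervalIntegral.integral_mono_on (by linarith) (hc.intervalIntegrable _ _)
      (continuous_const.intervalIntegrable _ _)
    intro x hx
    have h0 : 0 ≤ x := by have := hx.1; linarith
    apply Real.exp_le_exp.mpr
    apply Finset.sum_le_sum
    intro n _
    have := pow_le_one₀ (n := n) h0 hx.2
    gcongr
end
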